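/- Let G be a connected threshold graph on vertex set {0,1,…,n} (n≥1) labeled by reverse degree sequence. Then Ehr_{q,1}(F_G) = Σ_P q^{codeg(P)}, where the sum ranges over all G-parking functions P. -/

import Mathlib

open Finset Polynomial

namespace ThresholdFlow

/-- A threshold graph on `{0,…,n}` labeled by reverse degree sequence: whenever `i > j` are
adjacent and `i' ≤ i`, `j' ≤ j`, `i' ≠ j'`, then `i'` and `j'` are adjacent. -/
def IsThreshold (n : ℕ) (G : SimpleGraph (Fin (n+1))) : Prop :=
  ∀ i j i' j' : Fin (n+1), j < i → G.Adj i j → i' ≤ i → j' ≤ j → i' ≠ j' → G.Adj i' j'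

/-- An integer `a`-flow on `G`: nonnegative integers on the edges of `G` (oriented from the
larger endpoint `i` to the smaller endpoint `j`, recorded as `f i j`), with net flow `a i`
at every vertex `i ≠ 0`. -/
def IsFlow (n : ℕ) (G : SimpleGraph (Fin (n+1))) (a : Fin (n+1) → ℕ)
    (f : Fin (n+1) → Fin (n+1) → ℕ) : Prop :=
  (∀ i j, f i j ≠ 0 → j < i ∧ G.Adj i j) ∧
  (∀ i : Fin (n+1), i ≠ 0 → ∑ j, f i j = a i + ∑ j, f j i)

/-- The number of positive entries of a flow. -/
def posCount (n : ℕ) (f : Fin (n+1) → Fin (n+1) → ℕ) : ℕ :=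
  (Finset.univ.filter fun pr : Fin (n+1) × Fin (n+1) => 0 < f pr.1 pr.2).card

/-- `[b]_q = 1 + q + ⋯ + q^(b-1)` as a polynomial in `ℤ[q]`. -/
noncomputable def qnat (b : ℕ) : Polynomial ℤ := ∑ k ∈ Finset.range b, X ^ k

/-- `Ehr_{q,1}(F_G(a))`: the sum over integer `a`-flows with exactly `n` positive entries of
`∏_{e : f(e) > 0} [f(e)]_q`. -/
noncomputable def Ehr1 (n : ℕ) (G : SimpleGraph (Fin (n+1))) (a : Fin (n+1) → ℕ) :
    Polynomial ℤ :=
  ∑ᶠ f ∈ {f | IsFlow n G a f ∧ posCount n f = n},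
    ∏ i, ∏ j, if 0 < f i j then qnat (f i j) else 1

/-- `Ehr_{q,0}(F_G(a))`: the sum over all integer `a`-flows of
`(q-1)^(s(f)-n) ∏_{e : f(e) > 0} q^(f(e)-1)`. -/
noncomputable def Ehr0 (n : ℕ) (G : SimpleGraph (Fin (n+1))) (a : Fin (n+1) → ℕ) :
    Polynomial ℤ :=
  ∑ᶠ f ∈ {f | IsFlow n G a f},
    (X - 1) ^ (posCount n f - n) * ∏ i, ∏ j, if 0 < f i j then X ^ (f i j - 1) else 1

/-- `Ehr_{1,1}(F_G(a))`: the sum over integer `a`-flows with exactly `n` positive entries of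
the product of the positive entries. -/
noncomputable def Ehr11 (n : ℕ) (G : SimpleGraph (Fin (n+1))) (a : Fin (n+1) → ℕ) : ℕ :=
  ∑ᶠ f ∈ {f | IsFlow n G a f ∧ posCount n f = n},
    ∏ i, ∏ j, if 0 < f i j then f i j else 1

/-- A spanning tree of `G` rooted at `0`, encoded by its parent function `p`:
`p 0 = 0`, each `i ≠ 0` is adjacent in `G` to its parent `p i`, and iterating the parent
function from any vertex reaches the root `0`. -/
def IsSpanTree (n : ℕ) (G : SimpleGraph (Fin (n+1))) (p : Fin (n+1) → Fin (n+1)) : Prop :=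
  p 0 = 0 ∧ (∀ i, i ≠ 0 → G.Adj i (p i)) ∧ ∀ i, ∃ k, p^[k] i = 0

/-- `j` is a descendant of `i` in the rooted tree with parent function `p`
(in particular every vertex is a descendant of itself). -/
def Desc (n : ℕ) (p : Fin (n+1) → Fin (n+1)) (i j : Fin (n+1)) : Prop :=
  ∃ k, p^[k] j = i

/-- The set of inversions of the rooted tree `p`: pairs `(i,j)` with `i > j`, `i ≠ 0` and
`j` a descendant of `i`. -/
def invSet (n : ℕ) (p : Fin (n+1) → Fin (n+1)) : Set (Fin (n+1) × Fin (n+1)) :=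
  {pr | pr.2 < pr.1 ∧ pr.1 ≠ 0 ∧ Desc n p pr.1 pr.2}

/-- The number of inversions of the rooted tree `p`. -/
noncomputable def treeInv (n : ℕ) (p : Fin (n+1) → Fin (n+1)) : ℕ := (invSet n p).ncard

/-- A rooted spanning tree is increasing if it has no inversions. -/
def IsIncr (n : ℕ) (p : Fin (n+1) → Fin (n+1)) : Prop := invSet n p = ∅

/-- `δ_T(i)`: the number of descendants of `i` (including `i` itself). -/
noncomputable def delta (n : ℕ) (p : Fin (n+1) → Fin (n+1)) (i : Fin (n+1)) : ℕ :=
  Set.ncard {j | Desc n p i j}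

/-- `δ_T^a(i) = Σ_j a_j`, summed over the descendants `j` of `i` (including `i` itself). -/
noncomputable def deltaA (n : ℕ) (a : Fin (n+1) → ℕ) (p : Fin (n+1) → Fin (n+1))
    (i : Fin (n+1)) : ℕ :=
  ∑ᶠ j ∈ {j | Desc n p i j}, a j

/-- The degree `d_i` of vertex `i` in `G`. -/
noncomputable def deg (n : ℕ) (G : SimpleGraph (Fin (n+1))) (i : Fin (n+1)) : ℕ :=
  Set.ncard {j | G.Adj i j}

/-- `d̄_i`: the number of neighbors of `i` smaller than `i`. -/
noncomputable def dbar (n : ℕ) (G : SimpleGraph (Fin (n+1))) (i : Fin (n+1)) : ℕ :=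
  Set.ncard {j | j < i ∧ G.Adj i j}

/-- A `G`-parking function, encoded as `P : Fin (n+1) → ℕ` with `P 0 = 0`. -/
def IsParking (n : ℕ) (G : SimpleGraph (Fin (n+1))) (P : Fin (n+1) → ℕ) : Prop :=
  P 0 = 0 ∧ ∀ S : Finset (Fin (n+1)), S.Nonempty → (0 : Fin (n+1)) ∉ S →
    ∃ i ∈ S, P i < Set.ncard {j | j ∉ S ∧ G.Adj i j}

/-- `codeg(P) = (|E(G)| - n) - Σ_{i=1}^n P(i)`. -/
noncomputable def codeg (n : ℕ) (G : SimpleGraph (Fin (n+1))) (P : Fin (n+1) → ℕ) : ℕ :=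
  (Set.ncard G.edgeSet - n) - ∑ i, P i

/-- `[m]_q` as a Laurent polynomial. -/
noncomputable def lq (m : ℕ) : LaurentPolynomial ℤ :=
  ∑ k ∈ Finset.range m, LaurentPolynomial.T (k : ℤ)

/-- `[b]_{q^m} = 1 + q^m + ⋯ + q^{m(b-1)}` as a Laurent polynomial. -/
noncomputable def lqpow (m b : ℕ) : LaurentPolynomial ℤ :=
  ∑ k ∈ Finset.range b, LaurentPolynomial.T ((m : ℤ) * k)

/-- `wt_{q,q⁻¹}(b)`: the substitution `t = q⁻¹` in `wt_{q,t}(b) = Σ_{k=0}^{b-1} q^k t^{b-1-k}`,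
with `wt_{q,q⁻¹}(0) = 1`. -/
noncomputable def wtqq (b : ℕ) : LaurentPolynomial ℤ :=
  if b = 0 then 1 else ∑ k ∈ Finset.range b, LaurentPolynomial.T (2 * (k : ℤ) - ((b : ℤ) - 1))

/-- `Ehr_{q,q⁻¹}(F_G(a))`: the sum over all integer `a`-flows `f` of
`(-(1-q)(1-q⁻¹))^(s(f)-n) ∏_e wt_{q,q⁻¹}(f(e))`, as a Laurent polynomial in `q`. -/
noncomputable def Ehrqq (n : ℕ) (G : SimpleGraph (Fin (n+1))) (a : Fin (n+1) → ℕ) :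
    LaurentPolynomial ℤ :=
  ∑ᶠ f ∈ {f | IsFlow n G a f},
    (-((1 - LaurentPolynomial.T 1) * (1 - LaurentPolynomial.T (-1)))) ^ (posCount n f - n) *
      ∏ i, ∏ j, wtqq (f i j)

end ThresholdFlow

namespace ThresholdFlow
set_option linter.unusedSectionVars false

section ParkTheory

variable {V : Type*} [LinearOrder V] [Fintype V] (A : V → V → ℕ)

def PF (S : Finset V) (m : V → ℕ) : Set (V → ℕ) :=
  {P | (∀ i, i ∉ S → P i = 0) ∧
    ∀ T, T ⊆ S → T.Nonempty → ∃ i ∈ T, P i < m i + ∑ j ∈ S \ T, A i j}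

def ee (S : Finset V) : ℕ := ∑ i ∈ S, ∑ j ∈ S, if j < i then A i j else 0

def EE (S : Finset V) (m : V → ℕ) : ℕ := ∑ i ∈ S, m i + ee A S

noncomputable def Park (S : Finset V) (m : V → ℕ) : ℤ[X] :=
  ∑ᶠ P ∈ PF A S m, (X : ℤ[X]) ^ (EE A S m - S.card - ∑ i ∈ S, P i)

variable {A}

lemma ee_insert (hs : ∀ i j, A i j = A j i) {S : Finset V} {v : V} (hv : v ∉ S) :
    ee A (insert v S) = ee A S + ∑ j ∈ S, A j v := by
  unfold ee
  rw [sum_insert hv, sum_insert hv]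
  simp only [lt_irrefl, if_false, zero_add]
  have : ∀ i ∈ S, (∑ j ∈ insert v S, if j < i then A i j else 0)
      = (if v < i then A i v else 0) + ∑ j ∈ S, if j < i then A i j else 0 := by
    intro i _
    rw [sum_insert hv]
  rw [sum_congr rfl this, sum_add_distrib, ← add_assoc, ← sum_add_distrib, add_comm]
  congr 1
  apply sum_congr rfl
  intro j hj
  have : j ≠ v := fun h => hv (h ▸ hj)
  rcases lt_or_gt_of_ne this with h | h
  · simp [h, h.not_gt, hs v j]
  · simp [h, h.not_gt]

lemma EE_erase (hs : ∀ i j, A i j = A j i) {S : Finset V} {v : V} (hv : v ∈ S) (m : V → ℕ) :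
    EE A S m = EE A (S.erase v) (fun i => m i + A i v) + m v := by
  have h1 := ee_insert hs (notMem_erase v S)
  rw [insert_erase hv] at h1
  unfold EE
  rw [h1, sum_add_distrib, ← add_sum_erase _ _ hv]
  ring

lemma PF_erase {S : Finset V} {v : V} (hv : v ∈ S) {m P : V → ℕ} (hP : P ∈ PF A S m) :
    Function.update P v 0 ∈ PF A (S.erase v) (fun i => m i + A i v) := by
  refine ⟨?_, ?_⟩
  · intro i hi
    by_cases h : i = v
    · simp [h]
    · rw [Function.update_of_ne h]
      exact hP.1 i (fun h' => hi (mem_erase.2 ⟨h, h'⟩))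
  · intro T hT hne
    obtain ⟨i, hi, h⟩ := hP.2 T (hT.trans (erase_subset _ _)) hne
    refine ⟨i, hi, ?_⟩
    have hvT : v ∉ T := fun h => by simpa using hT h
    have hiv : i ≠ v := fun h => hvT (h ▸ hi)
    rw [Function.update_of_ne hiv]
    have : S \ T = insert v (S.erase v \ T) := by
      ext x; by_cases hx : x = v <;> simp [hx, hv, hvT]
    rw [this, sum_insert (by simp)] at h
    simpa [add_assoc] using h

lemma PF_insert {S : Finset V} {v : V} (hv : v ∈ S) {m P : V → ℕ} {k : ℕ} (hk : k < m v)
    (hP : P ∈ PF A (S.erase v) (fun i => m i + A i v)) :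
    Function.update P v k ∈ PF A S m := by
  refine ⟨?_, ?_⟩
  · intro i hi
    have h : i ≠ v := fun h => hi (h ▸ hv)
    rw [Function.update_of_ne h]
    exact hP.1 i (fun h' => hi (mem_of_mem_erase h'))
  · intro T hT hne
    by_cases hvT : v ∈ T
    · exact ⟨v, hvT, by simp; omega⟩
    obtain ⟨i, hi, h⟩ := hP.2 T (fun x hx => mem_erase.2 ⟨fun h => hvT (h ▸ hx), hT hx⟩) hne
    refine ⟨i, hi, ?_⟩
    have hiv : i ≠ v := fun h => hvT (h ▸ hi)
    rw [Function.update_of_ne hiv]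
    have : S \ T = insert v (S.erase v \ T) := by
      ext x; by_cases hx : x = v <;> simp [hx, hv, hvT]
    rw [this, sum_insert (by simp)]
    simpa [add_assoc] using h

lemma PF_shift {S : Finset V} {v : V} (hv : v ∈ S) {m P : V → ℕ} :
    Function.update P v (P v + m v) ∈ PF A S m ↔ P ∈ PF A S (Function.update m v 0) := by
  unfold PF
  simp only [Set.mem_ofPred_eq]
  refine and_congr ?_ ?_
  · refine forall_congr' fun i => ?_
    by_cases h : i = v
    · simp [h, hv]
    · simp [h]
  · refine forall_congr' fun T => forall_congr' fun _ => forall_congr' fun _ =>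
      exists_congr fun i => and_congr_right fun _ => ?_
    by_cases h : i = v
    · subst h; simp; omega
    · simp [h]

lemma PF_bound (hs : ∀ i j, A i j = A j i) : ∀ (S : Finset V) (m P : V → ℕ), P ∈ PF A S m →
    S.card + ∑ i ∈ S, P i ≤ EE A S m := by
  intro S
  induction S using Finset.strongInduction with
  | H S ih =>
    intro m P hP
    rcases S.eq_empty_or_nonempty with rfl | hne
    · simp
    obtain ⟨v, hv, h⟩ := hP.2 S subset_rfl hne
    simp at h
    have := ih _ (erase_ssubset hv) _ _ (PF_erase hv hP)
    rw [EE_erase hs hv m, ← add_sum_erase _ _ hv]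
    have h2 : ∑ i ∈ S.erase v, Function.update P v 0 i = ∑ i ∈ S.erase v, P i :=
      sum_congr rfl fun i hi => Function.update_of_ne (ne_of_mem_erase hi) _ _
    rw [h2] at this
    have := card_erase_add_one hv
    omega

lemma PF_finite (hs : ∀ i j, A i j = A j i) (S : Finset V) (m : V → ℕ) : (PF A S m).Finite := by
  apply (Set.finite_Iic (fun _ : V => EE A S m)).subset
  intro P hP
  rw [Set.mem_Iic]
  intro i
  show P i ≤ EE A S m
  by_cases hi : i ∈ S
  · have := PF_bound hs S m P hP
    have := single_le_sum (f := P) (fun _ _ => Nat.zero_le _) hi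
    omega
  · simp [hP.1 i hi]

lemma qnat_reflect (b : ℕ) : ∑ k ∈ range b, (X : ℤ[X]) ^ (b - 1 - k) = qnat b :=
  sum_range_reflect (fun k => (X : ℤ[X]) ^ k) b

lemma Park_rec (hs : ∀ i j, A i j = A j i) {S : Finset V} {v : V} (hv : v ∈ S) (m : V → ℕ) :
    Park A S m = qnat (m v) * Park A (S.erase v) (fun i => m i + A i v)
      + Park A S (Function.update m v 0) := by
  classical
  set m' : V → ℕ := fun i => m i + A i v with hm'
  have hsplit : PF A S m =
      (⋃ k ∈ (range (m v) : Set ℕ), (fun P => Function.update P v k) '' PF A (S.erase v) m')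
      ∪ (fun P => Function.update P v (P v + m v)) '' PF A S (Function.update m v 0) := by
    ext P
    constructor
    · intro hP
      by_cases h : P v < m v
      · left
        simp only [Set.mem_iUnion]
        exact ⟨P v, by simpa using h, _, PF_erase hv hP, by simp⟩
      · right
        have : Function.update (Function.update P v (P v - m v)) v
            (Function.update P v (P v - m v) v + m v) = P := by
          simp; omega
        refine ⟨Function.update P v (P v - m v), ?_, this⟩
        rw [← PF_shift hv, this]
        exact hP
    · rintro (h | h)
      · simp only [Set.mem_iUnion] at h
        obtain ⟨k, hk, P', hP', rfl⟩ := h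
        exact PF_insert hv (by simpa using hk) hP'
      · obtain ⟨P', hP', rfl⟩ := h
        exact (PF_shift hv).2 hP'
  have hfin1 : ∀ k ∈ (range (m v) : Set ℕ),
    ((fun P => Function.update P v k) '' PF A (S.erase v) m').Finite :=
    fun k _ => (PF_finite hs _ _).image _
  have hdisj : Disjoint
      (⋃ k ∈ (range (m v) : Set ℕ), (fun P => Function.update P v k) '' PF A (S.erase v) m')
      ((fun P => Function.update P v (P v + m v)) '' PF A S (Function.update m v 0)) := by
    rw [Set.disjoint_left]
    intro P h1 h2
    simp only [Set.mem_iUnion] at h1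
    obtain ⟨k, hk, P', hP', rfl⟩ := h1
    obtain ⟨P2, hP2, h⟩ := h2
    have := congrFun h v
    simp at this hk
    omega
  have hcard := card_erase_add_one hv
  have hEE : EE A S m = EE A (S.erase v) m' + m v := EE_erase hs hv m
  unfold Park
  rw [hsplit, finsum_mem_union hdisj ((finite_toSet _).biUnion hfin1)
    ((PF_finite hs _ _).image _)]
  congr 1
  · rw [finsum_mem_biUnion _ (finite_toSet _) hfin1, finsum_mem_coe_finset, ← qnat_reflect,
      sum_mul]
    · apply sum_congr rfl
      intro k hk
      rw [finsum_mem_image, mul_finsum_mem]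
      · apply finsum_mem_congr rfl
        intro P hP
        rw [← pow_add]
        congr 1
        have hb := PF_bound hs _ _ _ hP
        have h2 : ∑ i ∈ S.erase v, Function.update P v k i = ∑ i ∈ S.erase v, P i :=
          sum_congr rfl fun i hi => Function.update_of_ne (ne_of_mem_erase hi) _ _
        rw [← add_sum_erase _ _ hv, h2]
        simp only [Function.update_self]
        simp at hk
        omega
      · intro P hP Q hQ h
        ext i
        by_cases hi : i = v
        · subst hi; rw [hP.1 _ (by simp), hQ.1 _ (by simp)]
        · simpa [hi] using congrFun h i
    · intro k _ l _ hkl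
      rw [Function.onFun, Set.disjoint_left]
      rintro _ ⟨P, _, rfl⟩ ⟨Q, _, h⟩
      apply hkl
      simpa using (congrFun h v).symm
  · rw [finsum_mem_image]
    · apply finsum_mem_congr rfl
      intro P hP
      congr 1
      have h2 : ∑ i ∈ S.erase v, Function.update P v (P v + m v) i = ∑ i ∈ S.erase v, P i :=
        sum_congr rfl fun i hi => Function.update_of_ne (ne_of_mem_erase hi) _ _
      have h3 : ∑ i ∈ S.erase v, Function.update m v 0 i = ∑ i ∈ S.erase v, m i :=
        sum_congr rfl fun i hi => Function.update_of_ne (ne_of_mem_erase hi) _ _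
      unfold EE
      rw [← add_sum_erase _ _ hv, ← add_sum_erase _ _ hv, ← add_sum_erase _ _ hv,
        ← add_sum_erase _ _ hv, h2, h3]
      simp only [Function.update_self]
      omega
    · intro P hP Q hQ h
      ext i
      by_cases hi : i = v
      · subst hi; simpa using congrFun h i
      · simpa [hi] using congrFun h i

lemma Park_empty (m : V → ℕ) : Park A ∅ m = 1 := by
  have : PF A ∅ m = {0} := by
    ext P
    simp only [PF, Set.mem_ofPred_eq, Set.mem_singleton_iff]
    constructor
    · intro h; ext i; simpa using h.1 i
    · rintro rfl
      refine ⟨by simp, ?_⟩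
      intro T hT hne
      rw [subset_empty.1 hT] at hne
      simp at hne
  unfold Park
  rw [this]
  simp [EE, ee]

lemma PF_congr {S : Finset V} {m m' : V → ℕ} (h : ∀ i ∈ S, m i = m' i) :
    PF A S m = PF A S m' := by
  unfold PF
  ext P
  simp only [Set.mem_ofPred_eq]
  refine and_congr_right fun _ => forall_congr' fun T => forall_congr' fun hT =>
    forall_congr' fun _ => exists_congr fun i => and_congr_right fun hi => ?_
  rw [h i (hT hi)]

lemma Park_congr {S : Finset V} {m m' : V → ℕ} (h : ∀ i ∈ S, m i = m' i) :
    Park A S m = Park A S m' := by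
  unfold Park EE
  rw [PF_congr h, sum_congr rfl h]

lemma Park_zero {S : Finset V} {m : V → ℕ} {u : V} (hu : u ∈ S) (h : m u = 0)
    (hA : ∀ j ∈ S, A u j = 0) : Park A S m = 0 := by
  have : PF A S m = ∅ := by
    rw [Set.eq_empty_iff_forall_notMem]
    intro P hP
    obtain ⟨i, hi, h'⟩ := hP.2 {u} (by simpa using hu) (by simp)
    rw [mem_singleton] at hi
    subst hi
    rw [h, sum_eq_zero fun j hj => hA j (mem_sdiff.1 hj).1] at h'
    omega
  unfold Park
  rw [this, finsum_mem_empty]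

lemma Park_zero' {S : Finset V} {m : V → ℕ} (hne : S.Nonempty) (h : ∀ i ∈ S, m i = 0) :
    Park A S m = 0 := by
  have : PF A S m = ∅ := by
    rw [Set.eq_empty_iff_forall_notMem]
    intro P hP
    obtain ⟨i, hi, h'⟩ := hP.2 S subset_rfl hne
    simp [h i hi] at h'
  unfold Park
  rw [this, finsum_mem_empty]


variable (A) in
noncomputable def KK (S : Finset V) (m : V → ℕ) : ℤ[X] := (X - 1) ^ S.card * Park A S m

lemma qnat_mul (b : ℕ) : (X - 1) * qnat b = X ^ b - 1 := by
  rw [mul_comm]; exact geom_sum_mul X b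

lemma KK_rec (hs : ∀ i j, A i j = A j i) {U : Finset V} {v : V} (hv : v ∉ U) (m : V → ℕ) :
    KK A (insert v U) m = (X ^ m v - 1) * KK A U (fun i => m i + A i v)
      + KK A (insert v U) (Function.update m v 0) := by
  unfold KK
  rw [Park_rec hs (mem_insert_self v U), erase_insert hv, card_insert_of_notMem hv, ← qnat_mul]
  ring

lemma KK_congr {S : Finset V} {m m' : V → ℕ} (h : ∀ i ∈ S, m i = m' i) :
    KK A S m = KK A S m' := by
  unfold KK; rw [Park_congr h]

lemma sdiff_insert' {U D : Finset V} {v : V} (hv : v ∉ U) :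
    insert v U \ insert v D = U \ D := by
  ext x
  by_cases h : x = v
  · subst h; simp [hv]
  · simp [h]

lemma WW' (hs : ∀ i j, A i j = A j i) : ∀ (k N : ℕ) (S : Finset V) (m : V → ℕ),
    S.card = k → ∑ i ∈ S, m i = N →
    ∑ D ∈ S.powerset, KK A D m * X ^ ee A (S \ D) = X ^ EE A S m := by
  intro k
  induction k using Nat.strong_induction_on with
  | _ k ihk =>
  intro N
  induction N using Nat.strong_induction_on with
  | _ N ih =>
    intro S m hk hN
    by_cases h0 : ∀ i ∈ S, m i = 0
    · rw [sum_eq_single ∅]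
      · simp [KK, Park_empty, EE, sum_eq_zero h0]
      · intro D hD hne
        rw [KK, Park_zero' (nonempty_iff_ne_empty.2 hne)
          (fun i hi => h0 i (mem_powerset.1 hD hi))]
        simp
      · simp
    · push Not at h0
      obtain ⟨v, hv, hmv⟩ := h0
      obtain ⟨U, hvU, rfl⟩ : ∃ U, v ∉ U ∧ S = insert v U :=
        ⟨S.erase v, by simp, (insert_erase hv).symm⟩
      have hU : ∀ D ⊆ U, ∀ i ∈ D, m i = Function.update m v 0 i := by
        intro D hD i hi
        rw [Function.update_of_ne]
        rintro rfl
        exact hvU (hD hi)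
      have hsum : ∑ i ∈ U, Function.update m v 0 i = ∑ i ∈ U, m i :=
        (sum_congr rfl (hU U subset_rfl)).symm
      rw [sum_insert hvU] at hN
      rw [card_insert_of_notMem hvU] at hk
      have h1 := ih (∑ i ∈ U, m i) (by omega) (insert v U) (Function.update m v 0)
        (by rw [card_insert_of_notMem hvU, hk]) (by rw [sum_insert hvU, hsum]; simp)
      have h2 : ∑ D ∈ U.powerset, KK A D (fun i => m i + A i v) * X ^ ee A (U \ D)
          = X ^ EE A U (fun i => m i + A i v) :=
        ihk U.card (by omega) _ U _ rfl rfl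
      rw [sum_powerset_insert hvU] at h1 ⊢
      have h3 : ∑ D ∈ U.powerset, KK A D m * X ^ ee A (insert v U \ D)
          = ∑ D ∈ U.powerset, KK A D (Function.update m v 0) * X ^ ee A (insert v U \ D) :=
        sum_congr rfl fun D hD => by rw [KK_congr (hU D (mem_powerset.1 hD))]
      have h4 : ∑ D ∈ U.powerset, KK A (insert v D) m * X ^ ee A (insert v U \ insert v D)
          = (X ^ m v - 1) * ∑ D ∈ U.powerset, KK A D (fun i => m i + A i v) * X ^ ee A (U \ D)
          + ∑ D ∈ U.powerset, KK A (insert v D) (Function.update m v 0)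
              * X ^ ee A (insert v U \ insert v D) := by
        rw [mul_sum, ← sum_add_distrib]
        refine sum_congr rfl fun D hD => ?_
        rw [KK_rec hs (fun h => hvU (mem_powerset.1 hD h)), sdiff_insert' hvU]
        ring
      have h5 : EE A (insert v U) (Function.update m v 0) = EE A U (fun i => m i + A i v) := by
        unfold EE
        rw [sum_insert hvU, hsum, ee_insert hs hvU, sum_add_distrib]
        simp; ring
      have h6 : EE A (insert v U) m = EE A U (fun i => m i + A i v) + m v := by
        have := EE_erase hs (mem_insert_self v U) m
        rwa [erase_insert hvU] at this
      rw [h3, h4, h2, h6, pow_add]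
      rw [h5] at h1
      linear_combination h1

lemma WW (hs : ∀ i j, A i j = A j i) (S : Finset V) (m : V → ℕ) :
    ∑ D ∈ S.powerset, KK A D m * X ^ ee A (S \ D) = X ^ EE A S m :=
  WW' hs _ _ S m rfl rfl

lemma sum_swap1 {R : Type*} [AddCommMonoid R] (U : Finset V) (f : Finset V → Finset V → R) :
    ∑ D ∈ U.powerset, ∑ E ∈ D.powerset, f E (D \ E)
      = ∑ E ∈ U.powerset, ∑ F ∈ (U \ E).powerset, f E F := by
  rw [sum_sigma', sum_sigma']
  refine sum_nbij' (fun p => ⟨p.2, p.1 \ p.2⟩) (fun p => ⟨p.1 ∪ p.2, p.1⟩) ?_ ?_ ?_ ?_ ?_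
  · rintro ⟨D, E⟩ h
    simp only [mem_sigma, mem_powerset] at h ⊢
    exact ⟨h.2.trans h.1, sdiff_subset_sdiff h.1 subset_rfl⟩
  · rintro ⟨D, E⟩ h
    simp only [mem_sigma, mem_powerset] at h ⊢
    exact ⟨union_subset h.1 (h.2.trans sdiff_subset), subset_union_left⟩
  · rintro ⟨D, E⟩ h
    simp only [mem_sigma, mem_powerset] at h ⊢
    simp [union_eq_right.2 h.2]
  · rintro ⟨D, E⟩ h
    simp only [mem_sigma, mem_powerset] at h ⊢
    have : Disjoint E D := (subset_sdiff.1 h.2).2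
    simp [union_sdiff_left, sdiff_eq_self_of_disjoint this]
  · rintro ⟨D, E⟩ h
    rfl

lemma sum_swap2 {R : Type*} [AddCommMonoid R] (U : Finset V) (f : Finset V → Finset V → R) :
    ∑ D ∈ U.powerset, ∑ E ∈ (U \ D).powerset, f D E
      = ∑ E ∈ U.powerset, ∑ D ∈ (U \ E).powerset, f D E := by
  apply sum_comm'
  intro D E
  simp only [mem_powerset, subset_sdiff, disjoint_comm (a := D)]
  tauto

lemma conv_unique {v : V} {f g : Finset V → ℤ[X]}
    (h : ∀ U, v ∉ U → ∑ D ∈ U.powerset, f D * X ^ ee A (U \ D)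
      = ∑ D ∈ U.powerset, g D * X ^ ee A (U \ D)) :
    ∀ U, v ∉ U → f U = g U := by
  intro U
  induction U using Finset.strongInduction with
  | H U ih =>
    intro hv
    have h1 := h U hv
    rw [← add_sum_erase _ _ (mem_powerset_self U), ← add_sum_erase _ _ (mem_powerset_self U)] at h1
    have h2 : ∑ D ∈ U.powerset.erase U, f D * X ^ ee A (U \ D)
        = ∑ D ∈ U.powerset.erase U, g D * X ^ ee A (U \ D) := by
      refine sum_congr rfl fun D hD => ?_
      rw [mem_erase, mem_powerset] at hD
      rw [ih D (hD.2.ssubset_of_ne hD.1) (fun h => hv (hD.2 h))]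
    rw [h2] at h1
    simpa [ee] using add_right_cancel h1

lemma KK_min (hs : ∀ i j, A i j = A j i) (m : V → ℕ) (v : V) : ∀ U, v ∉ U →
    KK A (insert v U) m = ∑ D ∈ U.powerset,
      (X ^ (∑ i ∈ D, m i + m v) - 1) * KK A D (fun i => A i v) * KK A (U \ D) m := by
  apply conv_unique (A := A)
  intro U hv
  set B : V → ℕ := fun i => A i v with hB
  set T : ℤ[X] := ∑ E ∈ U.powerset, KK A E B * X ^ EE A (U \ E) m with hT
  have hins : ∀ W, v ∉ W → ee A (insert v W) = EE A W B := by
    intro W hW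
    rw [ee_insert hs hW, EE, add_comm]
  have h1 := WW hs (insert v U) m
  rw [sum_powerset_insert hv] at h1
  have h2 : ∑ D ∈ U.powerset, KK A D m * X ^ ee A (insert v U \ D) = T := by
    have : ∀ D ∈ U.powerset, KK A D m * X ^ ee A (insert v U \ D)
        = ∑ E ∈ (U \ D).powerset, KK A D m * (KK A E B * X ^ ee A (U \ (D ∪ E))) := by
      intro D hD
      have hvD : v ∉ D := fun h => hv (mem_powerset.1 hD h)
      rw [insert_sdiff_of_notMem _ hvD, hins _ (by simp [hv]), ← WW hs, mul_sum]
      refine sum_congr rfl fun E _ => ?_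
      rw [sdiff_sdiff_left]; rfl
    rw [sum_congr rfl this, sum_swap2, hT]
    refine sum_congr rfl fun E hE => ?_
    rw [← WW hs, mul_sum]
    refine sum_congr rfl fun D _ => ?_
    rw [sdiff_sdiff_left, sup_eq_union, union_comm]
    ring
  have h3 : ∑ D ∈ U.powerset, KK A (insert v D) m * X ^ ee A (insert v U \ insert v D)
      = ∑ D ∈ U.powerset, KK A (insert v D) m * X ^ ee A (U \ D) :=
    sum_congr rfl fun D _ => by rw [sdiff_insert' hv]
  rw [h2, h3] at h1
  have h4 : ∑ D ∈ U.powerset, (∑ E ∈ D.powerset,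
      (X ^ (∑ i ∈ E, m i + m v) - 1) * KK A E B * KK A (D \ E) m) * X ^ ee A (U \ D)
      = X ^ (EE A (insert v U) m) - T := by
    have : ∀ D ∈ U.powerset, (∑ E ∈ D.powerset,
        (X ^ (∑ i ∈ E, m i + m v) - 1) * KK A E B * KK A (D \ E) m) * X ^ ee A (U \ D)
        = ∑ E ∈ D.powerset, (fun E F => (X ^ (∑ i ∈ E, m i + m v) - 1) * KK A E B *
          (KK A F m * X ^ ee A ((U \ E) \ F))) E (D \ E) := by
      intro D hD
      rw [sum_mul]
      refine sum_congr rfl fun E hE => ?_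
      have : (U \ E) \ (D \ E) = U \ D := by
        rw [sdiff_sdiff_left, sup_eq_union, union_sdiff_of_subset (mem_powerset.1 hE)]
      simp only [this]
      ring
    rw [sum_congr rfl this, sum_swap1 U (fun E F => (X ^ (∑ i ∈ E, m i + m v) - 1) * KK A E B *
          (KK A F m * X ^ ee A ((U \ E) \ F)))]
    have : ∀ E ∈ U.powerset, ∑ F ∈ (U \ E).powerset,
        (fun E F => (X ^ (∑ i ∈ E, m i + m v) - 1) * KK A E B *
          (KK A F m * X ^ ee A ((U \ E) \ F))) E F
        = X ^ (m v + ∑ i ∈ U, m i) * (KK A E B * X ^ ee A (U \ E))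
          - KK A E B * X ^ EE A (U \ E) m := by
      intro E hE
      rw [← mul_sum, WW hs, EE, ← sum_sdiff (mem_powerset.1 hE)]
      ring
    rw [sum_congr rfl this, sum_sub_distrib, ← mul_sum, WW hs, ← hT, ← pow_add]
    congr 2
    rw [EE, EE, sum_insert hv, ee_insert hs hv]
    ring
  rw [h4, ← h1]
  ring

lemma Park_min (hs : ∀ i j, A i j = A j i) (m : V → ℕ) {v : V} {U : Finset V} (hv : v ∉ U) :
    Park A (insert v U) m = ∑ D ∈ U.powerset,
      qnat (∑ i ∈ D, m i + m v) * Park A D (fun i => A i v) * Park A (U \ D) m := by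
  have h := KK_min hs m v U hv
  have hx : (X - 1 : ℤ[X]) ≠ 0 := by
    simpa using X_sub_C_ne_zero (1 : ℤ)
  apply mul_left_cancel₀ (pow_ne_zero (U.card + 1) hx)
  rw [KK, card_insert_of_notMem hv] at h
  rw [h, mul_sum]
  refine sum_congr rfl fun D hD => ?_
  rw [KK, KK, ← qnat_mul, ← card_sdiff_add_card_eq_card (mem_powerset.1 hD)]
  ring

end ParkTheory

section FlowTheory

variable {n : ℕ} (G : SimpleGraph (Fin (n+1)))

def FS (S : Finset (Fin (n+1))) (a : Fin (n+1) → ℕ) : Set (Fin (n+1) → Fin (n+1) → ℕ) :=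
  {f | (∀ i j, f i j ≠ 0 → i ∈ S ∧ j ∈ insert 0 S ∧ j < i ∧ G.Adj i j) ∧
    (∀ i ∈ S, ∑ j, f i j = a i + ∑ j, f j i) ∧
    ∀ i ∈ S, ∃ p, ∀ j, j ≠ p → f i j = 0}

noncomputable def wt (f : Fin (n+1) → Fin (n+1) → ℕ) : ℤ[X] :=
  ∏ i, ∏ j, if 0 < f i j then qnat (f i j) else 1

noncomputable def Phi (S : Finset (Fin (n+1))) (a : Fin (n+1) → ℕ) : ℤ[X] :=
  ∑ᶠ f ∈ FS G S a, wt f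

def bump (a : Fin (n+1) → ℕ) (p : Fin (n+1)) (c : ℕ) : Fin (n+1) → ℕ :=
  fun i => a i + if i = p then c else 0

def addRow (u p : Fin (n+1)) (c : ℕ) (f : Fin (n+1) → Fin (n+1) → ℕ) :
    Fin (n+1) → Fin (n+1) → ℕ :=
  fun i j => if i = u then (if j = p then c else 0) else f i j

variable {G}

lemma FS_row {S : Finset (Fin (n+1))} {a : Fin (n+1) → ℕ} {f : Fin (n+1) → Fin (n+1) → ℕ}
    (hf : f ∈ FS G S a) {u : Fin (n+1)} (hu : u ∉ S) (j : Fin (n+1)) : f u j = 0 := by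
  by_contra h
  exact hu (hf.1 u j h).1

lemma FS_col {S : Finset (Fin (n+1))} {a : Fin (n+1) → ℕ} {f : Fin (n+1) → Fin (n+1) → ℕ}
    (hf : f ∈ FS G S a) {u : Fin (n+1)} (hu : ∀ x ∈ S, x ≤ u) (j : Fin (n+1)) : f j u = 0 := by
  by_contra h
  have := hf.1 j u h
  exact absurd this.2.2.1 (not_lt.2 (hu j this.1))

lemma addRow_row_self (u p : Fin (n+1)) (c : ℕ) (f : Fin (n+1) → Fin (n+1) → ℕ) :
    ∑ j, addRow u p c f u j = c := by
  simp [addRow]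

lemma addRow_row_ne {u p i : Fin (n+1)} (hi : i ≠ u) (c : ℕ)
    (f : Fin (n+1) → Fin (n+1) → ℕ) (j) : addRow u p c f i j = f i j := by
  simp [addRow, hi]

lemma addRow_col {u p : Fin (n+1)} (c : ℕ) {f : Fin (n+1) → Fin (n+1) → ℕ}
    (hf : ∀ j, f u j = 0) (i : Fin (n+1)) :
    ∑ j, addRow u p c f j i = (if i = p then c else 0) + ∑ j, f j i := by
  rw [← add_sum_erase _ _ (mem_univ u), ← add_sum_erase univ (fun j => f j i) (mem_univ u), hf]
  rw [zero_add]
  congr 1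
  · simp [addRow]
  · exact sum_congr rfl fun j hj => addRow_row_ne (ne_of_mem_erase hj) _ _ _

lemma wt_addRow {u p : Fin (n+1)} {c : ℕ} (hc : 0 < c) {f : Fin (n+1) → Fin (n+1) → ℕ}
    (hf : ∀ j, f u j = 0) : wt (addRow u p c f) = qnat c * wt f := by
  unfold wt
  rw [← mul_prod_erase _ _ (mem_univ u)]
  conv_rhs => rw [← mul_prod_erase _ _ (mem_univ u)]
  simp only [hf, lt_irrefl, if_false, prod_const_one, one_mul]
  congr 1
  · rw [prod_eq_single p]
    · simp [addRow, hc]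
    · intro j _ hj; simp [addRow, hj]
    · simp
  · refine prod_congr rfl fun i hi => ?_
    simp only [addRow_row_ne (ne_of_mem_erase hi)]

lemma FS_split {W : Finset (Fin (n+1))} {a : Fin (n+1) → ℕ} {u : Fin (n+1)}
    (hu0 : u ≠ 0) (hu : ∀ x ∈ W, x < u) (ha : 0 < a u) [DecidablePred (G.Adj u)] :
    FS G (insert u W) a = ⋃ p ∈ ((insert 0 W).filter (G.Adj u) : Set (Fin (n+1))),
      addRow u p (a u) '' FS G W (bump a p (a u)) := by
  have huW : u ∉ W := fun h => lt_irrefl _ (hu u h)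
  have hle : ∀ x ∈ insert u W, x ≤ u := by
    intro x hx
    rcases mem_insert.1 hx with rfl | hx
    · exact le_rfl
    · exact (hu x hx).le
  ext f
  simp only [Set.mem_iUnion]
  constructor
  · intro hf
    obtain ⟨p, hp⟩ := hf.2.2 u (mem_insert_self u W)
    have hsum := hf.2.1 u (mem_insert_self u W)
    rw [sum_eq_single p (fun j _ hj => hp j hj) (by simp),
      sum_eq_zero (fun j _ => FS_col hf hle j), add_zero] at hsum
    have hfp := hf.1 u p (by omega)
    have hf' : f = addRow u p (a u) (addRow u p 0 f) := by
      ext i j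
      by_cases hi : i = u
      · subst hi
        by_cases hj : j = p
        · subst hj; simp [addRow, hsum]
        · simp [addRow, hj, hp j hj]
      · simp [addRow, hi]
    have hrow : ∀ j, addRow u p 0 f u j = 0 := by simp [addRow]
    refine ⟨p, ?_, addRow u p 0 f, ?_, hf'.symm⟩
    · simp only [coe_filter, Set.mem_ofPred_eq]
      refine ⟨?_, hfp.2.2.2⟩
      have := hfp.2.1
      simp only [mem_insert] at this ⊢
      have := hfp.2.2.1.ne
      tauto
    · refine ⟨?_, ?_, ?_⟩
      · intro i j hij
        have hi : i ≠ u := by rintro rfl; exact hij (hrow j)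
        rw [addRow_row_ne hi] at hij
        obtain ⟨h1, h2, h3, h4⟩ := hf.1 i j hij
        have h1' : i ∈ W := (mem_insert.1 h1).resolve_left hi
        refine ⟨h1', ?_, h3, h4⟩
        have : j ≠ u := (h3.trans (hu i h1')).ne
        simp only [mem_insert] at h2 ⊢
        tauto
      · intro i hi
        have hiu : i ≠ u := fun h => huW (h ▸ hi)
        have h1 := hf.2.1 i (mem_insert_of_mem hi)
        have h2 : ∑ j, f j i = (if i = p then a u else 0) + ∑ j, addRow u p 0 f j i := by
          conv_lhs => rw [hf']
          exact addRow_col _ hrow i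
        rw [sum_congr rfl fun j _ => addRow_row_ne hiu 0 f j, h1, h2, bump, add_assoc]
      · intro i hi
        have hiu : i ≠ u := fun h => huW (h ▸ hi)
        obtain ⟨r, hr⟩ := hf.2.2 i (mem_insert_of_mem hi)
        exact ⟨r, fun j hj => by rw [addRow_row_ne hiu]; exact hr j hj⟩
  · rintro ⟨p, hp, f, hf, rfl⟩
    simp only [coe_filter, Set.mem_ofPred_eq] at hp
    have hrow : ∀ j, f u j = 0 := FS_row hf huW
    refine ⟨?_, ?_, ?_⟩
    · intro i j hij
      by_cases hi : i = u
      · subst hi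
        have hj : j = p := by
          by_contra h
          simp [addRow, h] at hij
        subst hj
        refine ⟨mem_insert_self _ _, ?_, ?_, hp.2⟩
        · have := hp.1
          simp only [mem_insert] at this ⊢
          tauto
        · rcases mem_insert.1 hp.1 with rfl | h
          · exact Fin.pos_of_ne_zero hu0
          · exact hu _ h
      · rw [addRow_row_ne hi] at hij
        obtain ⟨h1, h2, h3, h4⟩ := hf.1 i j hij
        refine ⟨mem_insert_of_mem h1, ?_, h3, h4⟩
        simp only [mem_insert] at h2 ⊢
        tauto
    · intro i hi
      rw [addRow_col _ hrow]
      by_cases hiu : i = u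
      · subst hiu
        rw [addRow_row_self, sum_eq_zero (fun j _ => FS_col hf (fun x hx => (hu x hx).le) j)]
        have : i ≠ p := hp.2.ne
        simp [this]
      · rw [sum_congr rfl fun j _ => addRow_row_ne hiu _ f j,
          hf.2.1 i ((mem_insert.1 hi).resolve_left hiu), bump, add_assoc]
    · intro i hi
      by_cases hiu : i = u
      · subst hiu
        exact ⟨p, fun j hj => by simp [addRow, hj]⟩
      · obtain ⟨r, hr⟩ := hf.2.2 i ((mem_insert.1 hi).resolve_left hiu)
        exact ⟨r, fun j hj => by rw [addRow_row_ne hiu]; exact hr j hj⟩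

lemma FS_empty (a : Fin (n+1) → ℕ) : FS G ∅ a = {0} := by
  ext f
  simp only [Set.mem_singleton_iff]
  constructor
  · intro hf
    ext i j
    exact FS_row hf (by simp) j
  · rintro rfl
    refine ⟨?_, ?_, ?_⟩ <;> simp

lemma bump_pos {W : Finset (Fin (n+1))} {a : Fin (n+1) → ℕ} (ha : ∀ i ∈ W, 0 < a i)
    (p : Fin (n+1)) (c : ℕ) : ∀ i ∈ W, 0 < bump a p c i := by
  intro i hi
  have := ha i hi
  unfold bump
  omega

lemma FS_finite (S : Finset (Fin (n+1))) : ∀ (a : Fin (n+1) → ℕ), 0 ∉ S →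
    (∀ i ∈ S, 0 < a i) → (FS G S a).Finite := by
  classical
  induction S using Finset.induction_on_max with
  | empty => intro a _ _; rw [FS_empty]; exact Set.finite_singleton _
  | insert u W hu ih =>
    intro a h0 ha
    simp only [mem_insert, not_or] at h0
    rw [FS_split (Ne.symm h0.1) hu (ha u (mem_insert_self _ _))]
    refine (finite_toSet _).biUnion fun p _ => (ih _ h0.2 ?_).image _
    exact bump_pos (fun i hi => ha i (mem_insert_of_mem hi)) _ _

lemma Phi_empty (a : Fin (n+1) → ℕ) : Phi G ∅ a = 1 := by
  unfold Phi
  rw [FS_empty, finsum_mem_singleton]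
  simp [wt]

lemma Phi_congr {S : Finset (Fin (n+1))} {a b : Fin (n+1) → ℕ} (h : ∀ i ∈ S, a i = b i) :
    Phi G S a = Phi G S b := by
  have : FS G S a = FS G S b := by
    ext f
    refine and_congr_right fun _ => and_congr_left fun _ => forall_congr' fun i =>
      forall_congr' fun hi => ?_
    rw [h i hi]
  unfold Phi
  rw [this]

lemma bump_of_notMem {S : Finset (Fin (n+1))} {p : Fin (n+1)} (hp : p ∉ S) (a : Fin (n+1) → ℕ)
    (c : ℕ) : ∀ i ∈ S, bump a p c i = a i := by
  intro i hi
  have : i ≠ p := fun h => hp (h ▸ hi)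
  simp [bump, this]

open Classical in
lemma Phi_max {W : Finset (Fin (n+1))} {a : Fin (n+1) → ℕ} {u : Fin (n+1)}
    (hu0 : u ≠ 0) (hW : 0 ∉ W) (hu : ∀ x ∈ W, x < u) (hpos : ∀ i ∈ insert u W, 0 < a i)
    (h0 : G.Adj u 0) :
    Phi G (insert u W) a = qnat (a u) *
      (Phi G W a + ∑ p ∈ W, if G.Adj u p then Phi G W (bump a p (a u)) else 0) := by
  have huW : u ∉ W := fun h => lt_irrefl _ (hu u h)
  have ha : 0 < a u := hpos u (mem_insert_self _ _)
  have hposW : ∀ i ∈ W, 0 < a i := fun i hi => hpos i (mem_insert_of_mem hi)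
  have key : Phi G (insert u W) a = ∑ p ∈ (insert 0 W).filter (G.Adj u),
      qnat (a u) * Phi G W (bump a p (a u)) := by
    unfold Phi
    rw [FS_split hu0 hu ha, finsum_mem_biUnion _ (finite_toSet _), finsum_mem_coe_finset]
    · refine sum_congr rfl fun p _ => ?_
      rw [finsum_mem_image, mul_finsum_mem]
      · refine finsum_mem_congr rfl fun f hf => ?_
        exact wt_addRow ha (FS_row hf huW)
      · intro f hf g hg h
        ext i j
        by_cases hi : i = u
        · subst hi; rw [FS_row hf huW, FS_row hg huW]
        · have := congrFun (congrFun h i) j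
          rwa [addRow_row_ne hi, addRow_row_ne hi] at this
    · exact fun p _ => (FS_finite W _ hW (bump_pos hposW _ _)).image _
    · intro p _ r _ hpr
      rw [Function.onFun, Set.disjoint_left]
      rintro _ ⟨f, _, rfl⟩ ⟨g, _, h⟩
      have := congrFun (congrFun h u) p
      simp [addRow, hpr] at this
      omega
  rw [key, ← mul_sum, sum_filter, sum_insert hW, if_pos h0,
    Phi_congr (bump_of_notMem hW a (a u))]

open Classical in
lemma Phi_min (hG : IsThreshold n G) (h0 : ∀ i, i ≠ 0 → G.Adj i 0) {v : Fin (n+1)} (hv0 : v ≠ 0)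
    (U : Finset (Fin (n+1))) : ∀ (a : Fin (n+1) → ℕ), 0 ∉ U → (∀ x ∈ U, v < x) →
    (∀ i ∈ insert v U, 0 < a i) →
    Phi G (insert v U) a = ∑ D ∈ U.powerset, if ∀ i ∈ D, G.Adj i v then
      qnat (∑ i ∈ D, a i + a v) * Phi G D a * Phi G (U \ D) a else 0 := by
  induction U using Finset.induction_on_max with
  | empty =>
    intro a _ _ ha
    rw [Phi_max hv0 (by simp) (by simp) ha (h0 v hv0)]
    simp [Phi_empty]
  | insert u W hu ih =>
    intro a h0U hv ha
    simp only [mem_insert, not_or] at h0U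
    obtain ⟨h0u, h0W⟩ := h0U
    have hu0 : u ≠ 0 := Ne.symm h0u
    have huW : u ∉ W := fun h => lt_irrefl _ (hu u h)
    have hvW : v ∉ W := fun h => lt_irrefl _ (hv v (mem_insert_of_mem h))
    have hvu : v < u := hv u (mem_insert_self _ _)
    have hposu : 0 < a u := ha u (by simp)
    have hposvW : ∀ i ∈ insert v W, 0 < a i := by
      intro i hi; apply ha; simp only [mem_insert] at hi ⊢; tauto
    have hpos : ∀ i ∈ insert u W, 0 < a i := by
      intro i hi; apply ha; simp only [mem_insert] at hi ⊢; tauto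
    have hmax : ∀ D ⊆ W, Phi G (insert u D) a = qnat (a u) *
      (Phi G D a + ∑ p ∈ D, if G.Adj u p then Phi G D (bump a p (a u)) else 0) := by
      intro D hD
      exact Phi_max hu0 (fun h => h0W (hD h)) (fun x hx => hu x (hD hx))
        (fun i hi => hpos i (insert_subset_insert _ hD hi)) (h0 u hu0)
    rw [insert_comm, Phi_max hu0 (by simp [h0W, hv0.symm]) (by
      intro x hx
      rcases mem_insert.1 hx with rfl | hx
      · exact hvu
      · exact hu x hx) (by rw [insert_comm]; exact ha) (h0 u hu0)]
    have hih : ∀ b : Fin (n+1) → ℕ, (∀ i ∈ insert v W, 0 < b i) → _ :=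
      fun b hb => ih b h0W (fun x hx => hv x (mem_insert_of_mem hx)) hb
    have hb : ∀ p ∈ insert v W, (if G.Adj u p then Phi G (insert v W) (bump a p (a u)) else 0)
        = ∑ D ∈ W.powerset, if G.Adj u p then (if ∀ i ∈ D, G.Adj i v then
          qnat (∑ i ∈ D, bump a p (a u) i + bump a p (a u) v) * Phi G D (bump a p (a u))
            * Phi G (W \ D) (bump a p (a u)) else 0) else 0 := by
      intro p _
      rw [hih _ (bump_pos hposvW p (a u))]
      split_ifs <;> simp
    rw [sum_congr rfl hb, sum_comm, hih a hposvW, ← sum_add_distrib, mul_sum,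
      sum_powerset_insert huW, ← sum_add_distrib]
    refine sum_congr rfl fun D hD => ?_
    rw [mem_powerset] at hD
    have huD : u ∉ D := fun h => huW (hD h)
    have hvD : v ∉ D := fun h => hvW (hD h)
    by_cases hDN : ∀ i ∈ D, G.Adj i v
    swap
    · have : ¬ ∀ i ∈ insert u D, G.Adj i v := fun h => hDN fun i hi => h i (mem_insert_of_mem hi)
      simp only [if_neg hDN, if_neg this]
      simp
    simp only [if_pos hDN]
    rw [sdiff_insert' huW, insert_sdiff_of_notMem _ huD, hmax D hD, hmax (W \ D) sdiff_subset,
      sum_insert hvW, ← sum_sdiff hD, sum_insert huD]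
    have e1 : ∀ p ∈ W \ D, (if G.Adj u p then
        qnat (∑ i ∈ D, bump a p (a u) i + bump a p (a u) v) * Phi G D (bump a p (a u))
            * Phi G (W \ D) (bump a p (a u)) else 0)
        = qnat (∑ i ∈ D, a i + a v) * Phi G D a *
          (if G.Adj u p then Phi G (W \ D) (bump a p (a u)) else 0) := by
      intro p hp
      rw [mem_sdiff] at hp
      have hpv : v ≠ p := fun h => hvW (h ▸ hp.1)
      rw [sum_congr rfl (bump_of_notMem hp.2 a (a u)), Phi_congr (bump_of_notMem hp.2 a (a u))]
      split_ifs <;> simp [bump, hpv]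
    have e2 : ∀ p ∈ D, (if G.Adj u p then
        qnat (∑ i ∈ D, bump a p (a u) i + bump a p (a u) v) * Phi G D (bump a p (a u))
            * Phi G (W \ D) (bump a p (a u)) else 0)
        = qnat (a u + ∑ i ∈ D, a i + a v) * Phi G (W \ D) a *
          (if G.Adj u p then Phi G D (bump a p (a u)) else 0) := by
      intro p hp
      have hpv : v ≠ p := fun h => hvD (h ▸ hp)
      have hpn : p ∉ W \ D := by simp [hp]
      have hs : ∑ i ∈ D, bump a p (a u) i = a u + ∑ i ∈ D, a i := by
        simp [bump, sum_add_distrib, hp, add_comm]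
      rw [hs, Phi_congr (bump_of_notMem hpn a (a u))]
      split_ifs <;> simp [bump, hpv]; ring
    rw [sum_congr rfl e1, sum_congr rfl e2, ← mul_sum, ← mul_sum]
    have e3 : Phi G D (bump a v (a u)) = Phi G D a := Phi_congr (bump_of_notMem hvD a (a u))
    have e4 : Phi G (W \ D) (bump a v (a u)) = Phi G (W \ D) a :=
      Phi_congr (bump_of_notMem (by simp [hvW]) a (a u))
    have e5 : ∑ i ∈ D, bump a v (a u) i + bump a v (a u) v = a u + ∑ i ∈ D, a i + a v := by
      rw [sum_congr rfl (bump_of_notMem hvD a (a u))]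
      simp [bump]; ring
    rw [e3, e4, e5]
    by_cases huv : G.Adj u v
    · have : ∀ i ∈ insert u D, G.Adj i v := by
        intro i hi
        rcases mem_insert.1 hi with rfl | hi
        · exact huv
        · exact hDN i hi
      rw [if_pos huv, if_pos this]
      ring
    · have h1 : ¬ ∀ i ∈ insert u D, G.Adj i v := fun h => huv (h u (mem_insert_self _ _))
      have h2 : ∑ p ∈ D, (if G.Adj u p then Phi G D (bump a p (a u)) else 0) = 0 := by
        refine sum_eq_zero fun p hp => if_neg fun h => huv ?_
        exact hG u p u v (hu p (hD hp)) h le_rfl (hv p (mem_insert_of_mem (hD hp))).le hvu.ne'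
      rw [if_neg huv, if_neg h1, h2]
      ring

end FlowTheory

open Classical in
noncomputable def adjA {n : ℕ} (G : SimpleGraph (Fin (n+1))) : Fin (n+1) → Fin (n+1) → ℕ :=
  fun i j => if G.Adj i j then 1 else 0

lemma adjA_symm {n : ℕ} (G : SimpleGraph (Fin (n+1))) (i j) : adjA G i j = adjA G j i := by
  unfold adjA
  by_cases h : G.Adj i j
  · rw [if_pos h, if_pos h.symm]
  · rw [if_neg h, if_neg (fun h2 => h h2.symm)]

lemma Park_eq_Phi {n : ℕ} {G : SimpleGraph (Fin (n+1))} (hG : IsThreshold n G)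
    (h0 : ∀ i, i ≠ 0 → G.Adj i 0) (S : Finset (Fin (n+1))) (hS : 0 ∉ S) :
    Park (adjA G) S (fun _ => 1) = Phi G S (fun _ => 1) := by
  classical
  induction S using Finset.strongInduction with
  | H S ih =>
    rcases S.eq_empty_or_nonempty with rfl | hne
    · rw [Park_empty, Phi_empty]
    obtain ⟨v, hv, hmin⟩ : ∃ v ∈ S, ∀ x ∈ S, v ≤ x :=
      ⟨S.min' hne, S.min'_mem hne, fun x hx => S.min'_le x hx⟩
    obtain ⟨U, hvU, rfl⟩ : ∃ U, v ∉ U ∧ S = insert v U :=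
      ⟨S.erase v, by simp, (insert_erase hv).symm⟩
    simp only [mem_insert, not_or] at hS
    have hlt : ∀ x ∈ U, v < x := fun x hx =>
      lt_of_le_of_ne (hmin x (mem_insert_of_mem hx)) (fun h => hvU (h ▸ hx))
    have hsub : ∀ D ⊆ U, Park (adjA G) D (fun _ => 1) = Phi G D (fun _ => 1) := fun D hD =>
      ih D ((ssubset_insert hvU).trans_le' hD) (fun h => hS.2 (hD h))
    rw [Park_min (adjA_symm G) _ hvU, Phi_min hG h0 (Ne.symm hS.1) U _ hS.2 hlt (by simp)]
    refine sum_congr rfl fun D hD => ?_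
    rw [mem_powerset] at hD
    split_ifs with h
    · rw [Park_congr (m' := fun _ => 1) (fun i hi => by simp [adjA, h i hi]), hsub D hD,
        hsub (U \ D) sdiff_subset]
    · push Not at h
      obtain ⟨w, hw, hwv⟩ := h
      rw [Park_zero hw (by simp [adjA, hwv])]
      · simp
      · intro j hj
        unfold adjA
        refine if_neg fun hadj => hwv ?_
        rcases lt_trichotomy j w with h | h | h
        · exact hG w j w v h hadj le_rfl (hlt j (hD hj)).le (hlt w (hD hw)).ne'
        · exact absurd hadj (by rw [h]; exact G.irrefl)
        · exact hG j w w v h hadj.symm h.le (hlt w (hD hw)).le (hlt w (hD hw)).ne'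

lemma adj_zero {n : ℕ} {G : SimpleGraph (Fin (n+1))} (hG : IsThreshold n G)
    (hc : G.Connected) (i : Fin (n+1)) (hi : i ≠ 0) : G.Adj i 0 := by
  have : Nontrivial (Fin (n+1)) := ⟨i, 0, hi⟩
  obtain ⟨j, hj⟩ := hc.preconnected.exists_adj_of_nontrivial i
  rcases lt_or_gt_of_ne hj.ne with h | h
  · exact hG j i i 0 h hj.symm h.le (Fin.zero_le _) hi
  · exact hG i j i 0 h hj le_rfl (Fin.zero_le _) hi

lemma flow_set_eq {n : ℕ} (G : SimpleGraph (Fin (n+1))) :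
    {f | IsFlow n G (fun _ => 1) f ∧ posCount n f = n} = FS G (univ.erase 0) (fun _ => 1) := by
  have hsup : ∀ f : Fin (n+1) → Fin (n+1) → ℕ, (∀ i j, f i j ≠ 0 → j < i ∧ G.Adj i j) ↔
      ∀ i j, f i j ≠ 0 → i ∈ univ.erase 0 ∧ j ∈ insert 0 (univ.erase (0 : Fin (n+1))) ∧
        j < i ∧ G.Adj i j := by
    intro f
    refine forall_congr' fun i => forall_congr' fun j => forall_congr' fun _ => ?_
    rw [insert_erase (mem_univ _)]
    simp only [mem_erase, mem_univ, and_true, true_and]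
    exact ⟨fun h => ⟨fun h' => by simp [h'] at h, h⟩, fun h => h.2⟩
  ext f
  unfold FS IsFlow
  simp only [Set.mem_ofPred_eq, ← hsup, and_assoc]
  refine and_congr_right fun h1 => ?_
  have : (∀ i ∈ univ.erase (0 : Fin (n+1)), ∑ j, f i j = 1 + ∑ j, f j i) ↔
    (∀ i, i ≠ 0 → ∑ j, f i j = 1 + ∑ j, f j i) := by simp
  rw [this]
  refine and_congr_right fun h2 => ?_
  have hpc : posCount n f = ∑ i ∈ univ.erase (0 : Fin (n+1)), #{j | 0 < f i j} := by
    unfold posCount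
    rw [card_filter, ← univ_product_univ, sum_product, ← add_sum_erase _ _ (mem_univ 0)]
    have : ∀ j, f 0 j = 0 := by
      intro j; by_contra h; simpa using (h1 0 j h).1
    simp [this]
  have hn : n = ∑ i ∈ univ.erase (0 : Fin (n+1)), 1 := by simp
  have hge : ∀ i ∈ univ.erase (0 : Fin (n+1)), 1 ≤ #{j | 0 < f i j} := by
    intro i hi
    rw [Nat.one_le_iff_ne_zero, Finset.card_ne_zero]
    by_contra h
    rw [not_nonempty_iff_eq_empty, filter_eq_empty_iff] at h
    have := h2 i (ne_of_mem_erase hi)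
    rw [sum_eq_zero (fun j _ => by simpa using h (mem_univ j))] at this
    omega
  have hiff : posCount n f = n ↔ ∀ i ∈ univ.erase (0 : Fin (n+1)), 1 = #{j | 0 < f i j} := by
    rw [← sum_eq_sum_iff_of_le hge, ← hn, hpc, eq_comm]
  rw [hiff]
  refine forall_congr' fun i => forall_congr' fun hi => ?_
  constructor
  · intro h
    obtain ⟨p, hp⟩ := card_eq_one.1 h.symm
    refine ⟨p, fun j hj => ?_⟩
    by_contra h
    have : j ∈ ({j | 0 < f i j} : Finset (Fin (n+1))) := by simp; omega
    rw [hp] at this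
    exact hj (by simpa using this)
  · rintro ⟨p, hp⟩
    refine le_antisymm (hge i hi) ?_
    refine (card_le_card ?_).trans (card_singleton p).le
    intro j hj
    rw [mem_filter] at hj
    by_contra h
    have := hp j (by simpa using h)
    omega

lemma parking_set_eq {n : ℕ} {G : SimpleGraph (Fin (n+1))} (h0 : ∀ i, i ≠ 0 → G.Adj i 0) :
    {P | IsParking n G P} = PF (adjA G) (univ.erase 0) (fun _ => 1) := by
  classical
  ext P
  unfold IsParking PF
  simp only [Set.mem_ofPred_eq]
  refine and_congr (by simp) ?_
  have key : ∀ T : Finset (Fin (n+1)), 0 ∉ T → ∀ i ∈ T,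
      Set.ncard {j | j ∉ T ∧ G.Adj i j} = 1 + ∑ j ∈ univ.erase 0 \ T, adjA G i j := by
    intro T hT i hi
    have : {j | j ∉ T ∧ G.Adj i j} =
        ((insert 0 ((univ.erase 0 \ T).filter (G.Adj i)) : Finset (Fin (n+1))) : Set _) := by
      ext j
      have : G.Adj i 0 := h0 i (fun h => hT (h ▸ hi))
      by_cases hj : j = 0
      · subst hj; simp [hT, this]
      · simp [hj]
    rw [this, Set.ncard_coe_finset, card_insert_of_notMem (by simp), card_filter, add_comm]
    rfl
  have hsub : ∀ T : Finset (Fin (n+1)), T ⊆ univ.erase 0 ↔ 0 ∉ T := by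
    intro T
    rw [subset_erase]
    simp
  refine forall_congr' fun T => ?_
  rw [hsub]
  constructor
  · intro h h1 h2
    obtain ⟨i, hi, h'⟩ := h h2 h1
    exact ⟨i, hi, by rwa [key T h1 i hi] at h'⟩
  · intro h h1 h2
    obtain ⟨i, hi, h'⟩ := h h2 h1
    exact ⟨i, hi, by rwa [key T h2 i hi]⟩

lemma edge_card {n : ℕ} {G : SimpleGraph (Fin (n+1))} (h0 : ∀ i, i ≠ 0 → G.Adj i 0) :
    Set.ncard G.edgeSet = EE (adjA G) (univ.erase 0) (fun _ => 1) := by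
  classical
  have h1 : EE (adjA G) (univ.erase 0) (fun _ => 1) = ee (adjA G) univ := by
    have := ee_insert (adjA_symm G) (notMem_erase 0 univ)
    rw [insert_erase (mem_univ _)] at this
    rw [this, EE, add_comm]
    congr 1
    refine sum_congr rfl fun i hi => ?_
    simp [adjA, h0 i (ne_of_mem_erase hi)]
  have h2 : ee (adjA G) univ =
      (univ.filter fun pr : Fin (n+1) × Fin (n+1) => pr.2 < pr.1 ∧ G.Adj pr.1 pr.2).card := by
    rw [card_filter, ← univ_product_univ, sum_product]
    unfold ee adjA
    refine sum_congr rfl fun i _ => sum_congr rfl fun j _ => ?_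
    by_cases h : j < i <;> simp [h]
  rw [h1, h2, ← Set.ncard_coe_finset]
  symm
  refine Set.ncard_congr (fun pr _ => s(pr.1, pr.2)) ?_ ?_ ?_
  · rintro ⟨i, j⟩ h
    simpa using (by simpa using h : j < i ∧ G.Adj i j).2
  · rintro ⟨i, j⟩ ⟨i', j'⟩ h h' heq
    have h : j < i ∧ G.Adj i j := by simpa using h
    have h' : j' < i' ∧ G.Adj i' j' := by simpa using h'
    rcases Sym2.eq_iff.1 heq with ⟨rfl, rfl⟩ | ⟨rfl, rfl⟩
    · rfl
    · exact absurd h.1 h'.1.not_gt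
  · intro e
    induction e using Sym2.ind with
    | _ i j =>
      intro h
      rw [SimpleGraph.mem_edgeSet] at h
      rcases lt_or_gt_of_ne h.ne with hlt | hlt
      · exact ⟨(j, i), by simpa using ⟨hlt, h.symm⟩, Sym2.eq_swap⟩
      · exact ⟨(i, j), by simpa using ⟨hlt, h⟩, rfl⟩

theorem ehr_q1_eq_sum_parking (n : ℕ) (hn : 1 ≤ n) (G : SimpleGraph (Fin (n+1)))
    (hG : IsThreshold n G) (hc : G.Connected) :
    Ehr1 n G (fun _ => 1) =
      ∑ᶠ P ∈ {P | IsParking n G P}, (X : Polynomial ℤ) ^ codeg n G P := by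
  have h0 := adj_zero hG hc
  have h1 : Ehr1 n G (fun _ => 1) = Phi G (univ.erase 0) (fun _ => 1) := by
    unfold Ehr1 Phi
    rw [flow_set_eq]
    rfl
  rw [h1, ← Park_eq_Phi hG h0 _ (by simp), parking_set_eq h0, Park]
  refine finsum_mem_congr rfl fun P hP => ?_
  congr 1
  unfold codeg
  have hP0 : P 0 = 0 := hP.1 0 (by simp)
  rw [edge_card h0, ← add_sum_erase univ P (mem_univ 0), hP0]
  simp

end ThresholdFlow
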